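/- arXiv:1708.04832 — 2 statements merged into one kernel-verified Lean document; each statement's English description precedes it below -/
import Mathlib

section
/- Suppose φ : Γ → Γ is one-to-one and has no periodic point, and let x = (x_α), y = (y_α) ∈ X^Γ be such that the set {α ∈ Γ : x_α ≠ y_α} is finite. Then x is a transitive point of σ_φ if and only if y is a transitive point of σ_φ. -/
open Filter Topology

/-- `d : Y → Y → ℝ` is a metric on the topological space `Y` compatible with
(i.e. inducing) its topology. -/
def IsCompatibleMetric (Y : Type*) [t : TopologicalSpace Y] (d : Y → Y → ℝ) : Prop :=
  ∃ m : MetricSpace Y, m.toUniformSpace.toTopologicalSpace = t ∧ ∀ a b, m.dist a b = d a b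

/-- The generalized shift `σ_φ : X^Γ → X^Γ`, `σ_φ((x_α)_α) = (x_{φ(α)})_α`. -/
def genShift {X Γ : Type*} (φ : Γ → Γ) (x : Γ → X) : Γ → X := fun α => x (φ α)

/-- `θ` is a quasi-periodic point of `φ` iff its forward orbit `{φ^n(θ) : n ≥ 0}` is finite. -/
def QuasiPeriodic {Γ : Type*} (φ : Γ → Γ) (θ : Γ) : Prop :=
  (Set.range fun n : ℕ => φ^[n] θ).Finite

/-- `θ` is a periodic point of `φ` iff `φ^n(θ) = θ` for some `n ≥ 1`. -/
def PeriodicPt {Γ : Type*} (φ : Γ → Γ) (θ : Γ) : Prop := ∃ n ≥ 1, φ^[n] θ = θ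

/-- `ξ(x,y,t,n) = #{i ∈ {0,…,n−1} : d(f^i(x), f^i(y)) < t}`. -/
noncomputable def xiCount {Y : Type*} (d : Y → Y → ℝ) (f : Y → Y) (x y : Y) (t : ℝ) (n : ℕ) :
    ℕ :=
  {i : ℕ | i < n ∧ d (f^[i] x) (f^[i] y) < t}.ncard

/-- `F_{xy}(t) = liminf_n ξ(x,y,t,n)/n`. -/
noncomputable def Fdist {Y : Type*} (d : Y → Y → ℝ) (f : Y → Y) (x y : Y) (t : ℝ) : ℝ :=
  liminf (fun n : ℕ => (xiCount d f x y t n : ℝ) / n) atTop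

/-- `F*_{xy}(t) = limsup_n ξ(x,y,t,n)/n`. -/
noncomputable def FdistStar {Y : Type*} (d : Y → Y → ℝ) (f : Y → Y) (x y : Y) (t : ℝ) : ℝ :=
  limsup (fun n : ℕ => (xiCount d f x y t n : ℝ) / n) atTop

/-- `ζ(x,y,γ_D,n) = #{i ∈ {0,…,n−1} : (f^i(x), f^i(y)) ∈ γ_D}` where
`γ_D = {(u,v) : u_α = v_α for all α ∈ D}`. -/
noncomputable def zetaCount {X Γ : Type*} (f : (Γ → X) → (Γ → X)) (x y : Γ → X) (D : Set Γ)
    (n : ℕ) : ℕ :=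
  {i : ℕ | i < n ∧ ∀ α ∈ D, f^[i] x α = f^[i] y α}.ncard

/-- `G_{xy}(γ_D) = liminf_n ζ(x,y,γ_D,n)/n`. -/
noncomputable def Gdist {X Γ : Type*} (f : (Γ → X) → (Γ → X)) (x y : Γ → X) (D : Set Γ) : ℝ :=
  liminf (fun n : ℕ => (zetaCount f x y D n : ℝ) / n) atTop

/-- `G*_{xy}(γ_D) = limsup_n ζ(x,y,γ_D,n)/n`. -/
noncomputable def GdistStar {X Γ : Type*} (f : (Γ → X) → (Γ → X)) (x y : Γ → X) (D : Set Γ) :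
    ℝ :=
  limsup (fun n : ℕ => (zetaCount f x y D n : ℝ) / n) atTop

/-- `x, y` are distributionally scrambled of type 1 (w.r.t. the metric `d` and the map `f`). -/
def DistScrambled1 {Y : Type*} (d : Y → Y → ℝ) (f : Y → Y) (x y : Y) : Prop :=
  (∃ s > 0, Fdist d f x y s = 0) ∧ ∀ s > 0, FdistStar d f x y s = 1

/-- `x, y` are distributionally scrambled of type 2. -/
def DistScrambled2 {Y : Type*} (d : Y → Y → ℝ) (f : Y → Y) (x y : Y) : Prop :=
  (∃ s > 0, Fdist d f x y s < 1) ∧ ∀ s > 0, FdistStar d f x y s = 1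

/-- `x, y` are distributionally scrambled of type 3. -/
def DistScrambled3 {Y : Type*} (d : Y → Y → ℝ) (f : Y → Y) (x y : Y) : Prop :=
  ∃ a b : ℝ, 0 < a ∧ a < b ∧ ∀ s ∈ Set.Icc a b, Fdist d f x y s < FdistStar d f x y s

/-- `A` is a distributionally scrambled set of type 1: it has at least two elements and all
pairs of distinct points of `A` are distributionally scrambled of type 1. -/
def DistScrambledSet1 {Y : Type*} (d : Y → Y → ℝ) (f : Y → Y) (A : Set Y) : Prop :=
  A.Nontrivial ∧ ∀ x ∈ A, ∀ y ∈ A, x ≠ y → DistScrambled1 d f x y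

/-- `A` is a distributionally scrambled set of type 2. -/
def DistScrambledSet2 {Y : Type*} (d : Y → Y → ℝ) (f : Y → Y) (A : Set Y) : Prop :=
  A.Nontrivial ∧ ∀ x ∈ A, ∀ y ∈ A, x ≠ y → DistScrambled2 d f x y

/-- `A` is a distributionally scrambled set of type 3. -/
def DistScrambledSet3 {Y : Type*} (d : Y → Y → ℝ) (f : Y → Y) (A : Set Y) : Prop :=
  A.Nontrivial ∧ ∀ x ∈ A, ∀ y ∈ A, x ≠ y → DistScrambled3 d f x y

/-- `(Y,f)` is uniform distributionally chaotic: there is an uncountable distributionally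
scrambled set `A` of type 1 and a single `ε > 0` with `F_{xy}(ε) = 0` for distinct `x,y ∈ A`. -/
def UniformDC {Y : Type*} (d : Y → Y → ℝ) (f : Y → Y) : Prop :=
  ∃ A : Set Y, ¬ A.Countable ∧ DistScrambledSet1 d f A ∧
    ∃ ε > 0, ∀ x ∈ A, ∀ y ∈ A, x ≠ y → Fdist d f x y ε = 0

/-- `a` is a transitive point of `f`: its forward orbit is dense. -/
def TransitivePoint {Y : Type*} [TopologicalSpace Y] (f : Y → Y) (a : Y) : Prop :=
  Dense (Set.range fun n : ℕ => f^[n] a)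

/-- `(Y,f)` is dense distributionally chaotic: uniform distributional chaos witnessed by a
dense set. -/
def DenseDC {Y : Type*} [TopologicalSpace Y] (d : Y → Y → ℝ) (f : Y → Y) : Prop :=
  ∃ A : Set Y, ¬ A.Countable ∧ Dense A ∧ DistScrambledSet1 d f A ∧
    ∃ ε > 0, ∀ x ∈ A, ∀ y ∈ A, x ≠ y → Fdist d f x y ε = 0

/-- `(Y,f)` is transitive distributionally chaotic: uniform distributional chaos witnessed by a
dense set of transitive points. -/
def TransitiveDC {Y : Type*} [TopologicalSpace Y] (d : Y → Y → ℝ) (f : Y → Y) : Prop :=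
  ∃ A : Set Y, ¬ A.Countable ∧ Dense A ∧ (∀ a ∈ A, TransitivePoint f a) ∧
    DistScrambledSet1 d f A ∧
    ∃ ε > 0, ∀ x ∈ A, ∀ y ∈ A, x ≠ y → Fdist d f x y ε = 0

/-- The ω-limit set of `a` under `f`: all limits of `f^[n k] a` along strictly increasing
sequences `n`. -/
def OmegaSet {Y : Type*} [TopologicalSpace Y] (f : Y → Y) (a : Y) : Set Y :=
  {z | ∃ n : ℕ → ℕ, StrictMono n ∧ Tendsto (fun k => f^[n k] a) atTop (nhds z)}

/-- The set of periodic points of `f`. -/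
def PerSet {Y : Type*} (f : Y → Y) : Set Y := {y | ∃ n ≥ 1, f^[n] y = y}

/-- `x, y` are `ω^u`-scrambled. -/
def OmegaUScrambled {Y : Type*} [TopologicalSpace Y] (f : Y → Y) (x y : Y) : Prop :=
  ¬ (OmegaSet f x \ OmegaSet f y).Countable ∧
    (OmegaSet f x ∩ OmegaSet f y).Nonempty ∧ (OmegaSet f x \ PerSet f).Nonempty

/-- `x, y` are `ω^∞`-scrambled. -/
def OmegaInfScrambled {Y : Type*} [TopologicalSpace Y] (f : Y → Y) (x y : Y) : Prop :=
  (OmegaSet f x \ OmegaSet f y).Infinite ∧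
    (OmegaSet f x ∩ OmegaSet f y).Nonempty ∧ (OmegaSet f x \ PerSet f).Nonempty

/-- `A` is an `ω^u`-scrambled set. -/
def OmegaUScrambledSet {Y : Type*} [TopologicalSpace Y] (f : Y → Y) (A : Set Y) : Prop :=
  A.Nontrivial ∧ ∀ x ∈ A, ∀ y ∈ A, x ≠ y → OmegaUScrambled f x y

/-- `A` is an `ω^∞`-scrambled set. -/
def OmegaInfScrambledSet {Y : Type*} [TopologicalSpace Y] (f : Y → Y) (A : Set Y) : Prop :=
  A.Nontrivial ∧ ∀ x ∈ A, ∀ y ∈ A, x ≠ y → OmegaInfScrambled f x y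

variable {X : Type*} [Fintype X] [TopologicalSpace X] [DiscreteTopology X] [Nontrivial X]
variable {Γ : Type*} [Countable Γ] [Nonempty Γ]
theorem genShift_iterate {X Γ : Type*} (φ : Γ → Γ) (n : ℕ) (x : Γ → X) :
    (genShift φ)^[n] x = x ∘ φ^[n] := by
  induction n generalizing x with
  | zero => rfl
  | succ n ih =>
    rw [Function.iterate_succ_apply, ih, Function.iterate_succ']
    rfl

theorem continuous_genShift {X Γ : Type*} [TopologicalSpace X] (φ : Γ → Γ) :
    Continuous (genShift (X := X) φ) :=
  continuous_pi fun α => continuous_apply (φ α)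

theorem genShift_surjective {X Γ : Type*} [Nonempty X] {φ : Γ → Γ}
    (hinj : Function.Injective φ) : Function.Surjective (genShift (X := X) φ) :=
  hinj.surjective_comp_right

/-- A transitive point of a continuous surjection visits every nonempty open set at
arbitrarily late times. -/
theorem TransitivePoint.exists_ge_iterate_mem {Y : Type*} [TopologicalSpace Y] {f : Y → Y}
    {a : Y} (ha : TransitivePoint f a) (hf : Continuous f) (hs : Function.Surjective f)
    {U : Set Y} (hU : IsOpen U) (hne : U.Nonempty) (N : ℕ) : ∃ n ≥ N, f^[n] a ∈ U := by
  obtain ⟨_, hn, n, rfl⟩ := ha.inter_open_nonempty _ (hU.preimage (hf.iterate N))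
    (hne.preimage (hs.iterate N))
  exact ⟨N + n, Nat.le_add_right N n, by rwa [Function.iterate_add_apply]⟩

theorem iterate_injective_of_not_periodicPt {Γ : Type*} {φ : Γ → Γ}
    (hinj : Function.Injective φ) {θ : Γ} (hθ : ¬ PeriodicPt φ θ) :
    Function.Injective fun n : ℕ => φ^[n] θ := by
  refine Function.Injective.of_lt_imp_ne fun m n hmn h => hθ ⟨n - m, by lia, ?_⟩
  apply hinj.iterate m
  rw [← Function.iterate_add_apply, Nat.add_sub_cancel' hmn.le]
  exact h.symm

theorem eventually_iterate_notMem {Γ : Type*} {φ : Γ → Γ} (hinj : Function.Injective φ)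
    {θ : Γ} (hθ : ¬ PeriodicPt φ θ) {D : Set Γ} (hD : D.Finite) :
    ∀ᶠ n : ℕ in atTop, φ^[n] θ ∉ D := by
  rw [← Nat.cofinite_eq_atTop]
  exact (iterate_injective_of_not_periodicPt hinj hθ).tendsto_cofinite.eventually
    hD.eventually_cofinite_notMem

theorem TransitivePoint.of_finite_diff {X Γ : Type*} [TopologicalSpace X] [Nonempty X]
    {φ : Γ → Γ} (hinj : Function.Injective φ) (hper : ∀ θ : Γ, ¬ PeriodicPt φ θ)
    {x y : Γ → X} (hfin : {α : Γ | x α ≠ y α}.Finite)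
    (hx : TransitivePoint (genShift (X := X) φ) x) :
    TransitivePoint (genShift (X := X) φ) y := by
  refine dense_iff_inter_open.2 fun U hU ⟨v, hv⟩ => ?_
  obtain ⟨F, u, hu, hFU⟩ := isOpen_pi_iff.1 hU v hv
  have hev : ∀ᶠ n : ℕ in atTop, ∀ α ∈ F, φ^[n] α ∉ {α : Γ | x α ≠ y α} :=
    (Filter.eventually_all_finset F).2 fun α _ => eventually_iterate_notMem hinj (hper α) hfin
  obtain ⟨N, hN⟩ := eventually_atTop.1 hev
  obtain ⟨n, hn, hxn⟩ := hx.exists_ge_iterate_mem (continuous_genShift φ)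
    (genShift_surjective hinj) (isOpen_set_pi F.finite_toSet fun α hα => (hu α hα).1)
    ⟨v, fun α hα => (hu α hα).2⟩ N
  refine ⟨_, hFU fun α hα => ?_, n, rfl⟩
  have hxy : x (φ^[n] α) = y (φ^[n] α) := not_not.1 (hN n hn α hα)
  have hxu := hxn α hα
  simp only [genShift_iterate, Function.comp_apply] at hxu ⊢
  rwa [← hxy]

/-- if `φ` is one-to-one with no periodic point and `x, y ∈ X^Γ` differ on
only finitely many coordinates, then `x` is a transitive point of `σ_φ` iff `y` is. -/
theorem transitivePoint_iff_of_finite_diff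
    (φ : Γ → Γ) (hinj : Function.Injective φ) (hper : ∀ θ : Γ, ¬ PeriodicPt φ θ)
    (x y : Γ → X) (hfin : {α : Γ | x α ≠ y α}.Finite) :
    TransitivePoint (genShift (X := X) φ) x ↔ TransitivePoint (genShift (X := X) φ) y := by
  exact ⟨fun h => h.of_finite_diff hinj hper hfin,
    fun h => h.of_finite_diff hinj hper (by simpa only [ne_comm] using hfin)⟩
end

section
/- For any compatible metric d on X^Γ, the generalized shift dynamical system (X^Γ, σ_φ) is transitive distributional chaotic if and only if φ : Γ → Γ is one-to-one and has no periodic point. -/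
open Filter Topology

theorem genShift_iterate_apply {X Γ : Type*} (φ : Γ → Γ) (n : ℕ) (x : Γ → X) (γ : Γ) :
    (genShift φ)^[n] x γ = x (φ^[n] γ) := by
  induction n generalizing x with
  | zero => rfl
  | succ n ih => rw [Function.iterate_succ_apply, ih, genShift, Function.iterate_succ_apply']

section Necessity

variable {X Γ : Type*} [TopologicalSpace X] [DiscreteTopology X] [Nontrivial X]

theorem TransitivePoint.injective {φ : Γ → Γ} {a : Γ → X}
    (ha : TransitivePoint (genShift φ) a) : Function.Injective φ := by
  classical
  intro α β hφ
  by_contra hne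
  let U : Set (Γ → X) := {x | x α ≠ x β}
  have hU : IsOpen U :=
    isOpen_ne_fun (continuous_apply α) (continuous_apply β)
  have hsub : U ⊆ {a} := by
    have h1 : U ⊆ closure (U ∩ Set.range fun n : ℕ => (genShift φ)^[n] a) :=
      ha.open_subset_closure_inter hU
    refine h1.trans (closure_minimal ?_ isClosed_singleton)
    rintro _ ⟨hx, n, rfl⟩
    cases n with
    | zero => rfl
    | succ n =>
      refine absurd ?_ hx
      simp only [genShift_iterate_apply, Function.iterate_succ_apply, hφ]
  obtain ⟨p, r, hpr⟩ := exists_pair_ne X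
  have h1 : Function.update (fun _ => r) α p ∈ U := by
    simp [U, Function.update_of_ne (Ne.symm hne), hpr]
  have h2 : Function.update (fun _ => p) α r ∈ U := by
    simp [U, Function.update_of_ne (Ne.symm hne), hpr.symm]
  have h3 := congrFun ((hsub h1).trans (hsub h2).symm) α
  simp [hpr] at h3

theorem TransitivePoint.not_periodicPt {φ : Γ → Γ} {a : Γ → X}
    (ha : TransitivePoint (genShift φ) a) (θ : Γ) : ¬ PeriodicPt φ θ := by
  rintro ⟨n, hn, hθ⟩
  have key : ∀ c : X, a θ = c := by
    intro c
    have hU : IsOpen {x : Γ → X | ∀ i ∈ Finset.range n, x (φ^[i] θ) = c} := by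
      have : {x : Γ → X | ∀ i ∈ Finset.range n, x (φ^[i] θ) = c} =
          ⋂ i ∈ Finset.range n, (fun x : Γ → X => x (φ^[i] θ)) ⁻¹' {c} := by
        ext x; simp
      rw [this]
      exact isOpen_biInter_finset fun i _ =>
        (isOpen_discrete {c}).preimage (continuous_apply _)
    obtain ⟨_, hx, m, rfl⟩ := ha.inter_open_nonempty _ hU ⟨fun _ => c, fun _ _ => rfl⟩
    have hm : (genShift φ)^[m] a (φ^[(n * m - m) % n] θ) = c :=
      hx _ (Finset.mem_range.2 (Nat.mod_lt _ hn))
    have hper : Function.IsPeriodicPt φ n θ := hθ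
    rw [hper.iterate_mod_apply, genShift_iterate_apply, ← Function.iterate_add_apply,
      Nat.add_sub_cancel' (Nat.le_mul_of_pos_left m hn)] at hm
    rwa [(hper.mul_const m).eq] at hm
  obtain ⟨p, r, hpr⟩ := exists_pair_ne X
  exact hpr ((key p).symm.trans (key r))

end Necessity

theorem exists_finset_cylinder_subset {X Γ : Type*} [TopologicalSpace X]
    {U : Set (Γ → X)} (hU : IsOpen U) {y : Γ → X} (hy : y ∈ U) :
    ∃ D : Finset Γ, ∀ v : Γ → X, (∀ γ ∈ D, v γ = y γ) → v ∈ U := by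
  obtain ⟨D, u, hu, hsub⟩ := isOpen_pi_iff.1 hU y hy
  refine ⟨D, fun v hv => hsub fun γ hγ => ?_⟩
  rw [hv γ hγ]
  exact (hu γ hγ).2

section Metric

open Uniformity

variable {X Γ : Type*} [Finite X] [TopologicalSpace X] [DiscreteTopology X]
  {d : (Γ → X) → (Γ → X) → ℝ}

theorem IsCompatibleMetric.exists_finset_forall_lt (hd : IsCompatibleMetric (Γ → X) d)
    {s : ℝ} (hs : 0 < s) :
    ∃ D : Finset Γ, ∀ u v : Γ → X, (∀ γ ∈ D, u γ = v γ) → d u v < s := by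
  obtain ⟨m, hm, hdist⟩ := hd
  let uX : UniformSpace X := ⊥
  have huX : uX.toTopologicalSpace = ‹TopologicalSpace X› := DiscreteTopology.eq_bot.symm
  subst huX
  have hu : m.toUniformSpace = Pi.uniformSpace (fun _ : Γ => X) :=
    unique_uniformity_of_compact (t := Pi.topologicalSpace) hm rfl
  have h1 := @Metric.dist_mem_uniformity _ m.toPseudoMetricSpace _ hs
  rw [hu, Pi.uniformity] at h1
  have h2 : 𝓤 X = 𝓟 SetRel.id := rfl
  simp only [h2, comap_principal] at h1
  obtain ⟨D, hD, hsub⟩ := (hasBasis_iInf_principal_finite _).mem_iff.1 h1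
  refine ⟨hD.toFinset, fun u v huv => ?_⟩
  rw [← hdist]
  have h3 : (u, v) ∈ ⋂ γ ∈ D, (fun p : (Γ → X) × (Γ → X) => (p.1 γ, p.2 γ)) ⁻¹' SetRel.id := by
    simpa using huv
  exact hsub h3

theorem IsCompatibleMetric.exists_pos_forall_eq (hd : IsCompatibleMetric (Γ → X) d) (γ : Γ) :
    ∃ ε > 0, ∀ u v : Γ → X, d u v < ε → u γ = v γ := by
  obtain ⟨m, hm, hdist⟩ := hd
  let uX : UniformSpace X := ⊥
  have huX : uX.toTopologicalSpace = ‹TopologicalSpace X› := DiscreteTopology.eq_bot.symm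
  subst huX
  have hu : m.toUniformSpace = Pi.uniformSpace (fun _ : Γ => X) :=
    unique_uniformity_of_compact (t := Pi.topologicalSpace) hm rfl
  have h1 : {p : (Γ → X) × (Γ → X) | p.1 γ = p.2 γ} ∈ @uniformity _ m.toUniformSpace := by
    rw [hu, Pi.uniformity]
    refine mem_iInf_of_mem γ ⟨SetRel.id, mem_principal_self _, ?_⟩
    rintro ⟨u, v⟩ huv
    exact huv
  obtain ⟨ε, hε, h⟩ := (@Metric.mem_uniformity_dist _ m.toPseudoMetricSpace _).1 h1
  exact ⟨ε, hε, fun u v huv => h ((hdist u v).trans_lt huv)⟩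

end Metric

section Height

variable {Γ : Type*} {φ : Γ → Γ}

theorem iterate_injective_of_no_periodicPt (hφ : ∀ θ, ¬ PeriodicPt φ θ) (θ : Γ) :
    Function.Injective fun n : ℕ => φ^[n] θ := by
  have key : ∀ m n : ℕ, m < n → φ^[m] θ ≠ φ^[n] θ := by
    intro m n hmn h
    refine hφ (φ^[m] θ) ⟨n - m, by omega, ?_⟩
    rw [← Function.iterate_add_apply, Nat.sub_add_cancel hmn.le, h]
  intro m n h
  rcases lt_trichotomy m n with hmn | hmn | hmn
  · exact absurd h (key m n hmn)
  · exact hmn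
  · exact absurd h.symm (key n m hmn)

theorem exists_height (hφ : ∀ θ, ¬ PeriodicPt φ θ) :
    ∃ h : Γ → ℤ, ∀ γ, h (φ γ) = h γ + 1 := by
  let S : Setoid Γ :=
    { r := fun α β => ∃ m n : ℕ, φ^[m] α = φ^[n] β
      iseqv :=
        { refl := fun α => ⟨0, 0, rfl⟩
          symm := fun ⟨m, n, h⟩ => ⟨n, m, h.symm⟩
          trans := by
            rintro α β γ ⟨m, n, h⟩ ⟨k, l, h'⟩
            refine ⟨k + m, n + l, ?_⟩
            rw [Function.iterate_add_apply, h, ← Function.iterate_add_apply, add_comm,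
              Function.iterate_add_apply, h', ← Function.iterate_add_apply] } }
  let r : Γ → Γ := fun γ => (Quotient.mk S γ).out
  have hr : ∀ γ, ∃ m n : ℕ, φ^[m] γ = φ^[n] (r γ) := fun γ => S.symm (Quotient.mk_out γ)
  have hrφ : ∀ γ, r (φ γ) = r γ := fun γ =>
    congrArg Quotient.out (Quotient.sound (s := S) ⟨0, 1, rfl⟩)
  choose m n hmn using hr
  refine ⟨fun γ => n γ - m γ, fun γ => ?_⟩
  have h1 := hmn (φ γ)
  rw [hrφ, ← Function.iterate_succ_apply] at h1
  have h2 := hmn γ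
  have h3 : φ^[n (φ γ) + m γ] (r γ) = φ^[n γ + (m (φ γ) + 1)] (r γ) := by
    rw [add_comm, Function.iterate_add_apply, ← h1, ← Function.iterate_add_apply, add_comm (n γ),
      Function.iterate_add_apply _ _ (n γ), ← h2, ← Function.iterate_add_apply,
      add_comm (m γ)]
  have h4 := iterate_injective_of_no_periodicPt hφ (r γ) h3
  dsimp only
  omega

theorem height_iterate {h : Γ → ℤ} (hh : ∀ γ, h (φ γ) = h γ + 1) (n : ℕ) (γ : Γ) :
    h (φ^[n] γ) = h γ + n := by
  induction n with
  | zero => simp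
  | succ n ih => rw [Function.iterate_succ_apply', hh, ih]; push_cast; ring

theorem exists_natAbs_bound (h : Γ → ℤ) (D : Finset Γ) : ∃ H : ℕ, ∀ γ ∈ D, (h γ).natAbs ≤ H :=
  ⟨D.sup fun γ => (h γ).natAbs, fun _ hγ => Finset.le_sup (f := fun γ => (h γ).natAbs) hγ⟩

end Height

section Density

open scoped Nat

theorem ncard_lt_le_of_forall_block {P : ℕ → Prop} {H j : ℕ}
    (hP : ∀ n, j ! + H ≤ n → n + H < (j + 1)! → ¬ P n) :
    {i : ℕ | i < (j + 1)! ∧ P i}.ncard ≤ j ! + 2 * H := by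
  have hsub : {i : ℕ | i < (j + 1)! ∧ P i} ⊆
      (Finset.range (j ! + H) ∪ Finset.Ico ((j + 1)! - H) (j + 1)! : Finset ℕ) := by
    rintro i ⟨hi, hPi⟩
    have := fun h1 h2 => hP i h1 h2 hPi
    simp only [Finset.coe_union, Set.mem_union, Finset.mem_coe, Finset.mem_range, Finset.mem_Ico]
    by_contra! hc
    exact this (by omega) (by have := hc.2; omega)
  refine (Set.ncard_le_ncard hsub (Finset.finite_toSet _)).trans ?_
  rw [Set.ncard_coe_finset]
  refine (Finset.card_union_le _ _).trans ?_
  simp only [Finset.card_range, Nat.card_Ico]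
  omega

theorem ncard_lt_add_ncard_lt_not (P : ℕ → Prop) (n : ℕ) :
    {i : ℕ | i < n ∧ P i}.ncard + {i : ℕ | i < n ∧ ¬ P i}.ncard = n := by
  classical
  have h1 : {i : ℕ | i < n ∧ P i} = ((Finset.range n).filter P : Finset ℕ) := by ext; simp
  have h2 : {i : ℕ | i < n ∧ ¬ P i} = ((Finset.range n).filter (¬ P ·) : Finset ℕ) := by
    ext; simp
  rw [h1, h2, Set.ncard_coe_finset, Set.ncard_coe_finset,
    Finset.card_filter_add_card_filter_not, Finset.card_range]

theorem ncard_lt_div_nonneg (P : ℕ → Prop) (n : ℕ) :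
    (0 : ℝ) ≤ ({i : ℕ | i < n ∧ P i}.ncard : ℝ) / n := by positivity

theorem ncard_lt_div_le_one (P : ℕ → Prop) (n : ℕ) :
    ({i : ℕ | i < n ∧ P i}.ncard : ℝ) / n ≤ 1 := by
  refine div_le_one_of_le₀ ?_ (Nat.cast_nonneg _)
  have := ncard_lt_add_ncard_lt_not P n
  exact_mod_cast (by omega : {i : ℕ | i < n ∧ P i}.ncard ≤ n)

theorem frequently_ncard_lt_div_le {P : ℕ → Prop} {H : ℕ}
    (hP : ∃ᶠ j in atTop, ∀ n, j ! + H ≤ n → n + H < (j + 1)! → ¬ P n) {δ : ℝ} (hδ : 0 < δ) :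
    ∃ᶠ n : ℕ in atTop, ({i : ℕ | i < n ∧ P i}.ncard : ℝ) / n ≤ δ ∧ 0 < n := by
  have hlim : Tendsto (fun j : ℕ => (j + 1)!) atTop atTop :=
    tendsto_atTop_mono (fun j => Nat.self_le_factorial _) (tendsto_add_atTop_nat 1)
  have hsmall : ∀ᶠ j : ℕ in atTop, (1 + 2 * H : ℝ) / (j + 1) ≤ δ := by
    have : Tendsto (fun j : ℕ => (1 + 2 * H : ℝ) / ((j : ℝ) + 1)) atTop (𝓝 0) :=
      tendsto_const_nhds.div_atTop
        (tendsto_atTop_add_const_right _ _ tendsto_natCast_atTop_atTop)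
    exact (this.eventually_lt_const hδ).mono fun _ h => h.le
  refine hlim.frequently ((hP.and_eventually hsmall).mono ?_)
  rintro j ⟨hj, hjδ⟩
  refine ⟨le_trans ?_ hjδ, Nat.factorial_pos _⟩
  have h1 : ({i : ℕ | i < (j + 1)! ∧ P i}.ncard : ℝ) ≤ j ! + 2 * H := by
    exact_mod_cast ncard_lt_le_of_forall_block hj
  have h2 : (1 : ℝ) ≤ j ! := by exact_mod_cast Nat.factorial_pos j
  have h3 : (0 : ℝ) ≤ H := Nat.cast_nonneg _
  rw [div_le_div_iff₀ (by positivity) (by positivity)]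
  have h5 : ((j + 1)! : ℝ) = (j + 1) * j ! := by rw [Nat.factorial_succ]; push_cast; ring
  have h4 : (0 : ℝ) ≤ j + 1 := by positivity
  calc _ ≤ ((j ! : ℝ) + 2 * H) * (j + 1) := by gcongr
    _ ≤ (j ! + 2 * H * j !) * (j + 1) :=
      mul_le_mul_of_nonneg_right
        (add_le_add_right (le_mul_of_one_le_right (by positivity) h2) _) h4
    _ = _ := by rw [h5]; ring

theorem liminf_ncard_lt_div_eq_zero {P : ℕ → Prop} {H : ℕ}
    (hP : ∃ᶠ j in atTop, ∀ n, j ! + H ≤ n → n + H < (j + 1)! → ¬ P n) :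
    liminf (fun n : ℕ => ({i : ℕ | i < n ∧ P i}.ncard : ℝ) / n) atTop = 0 := by
  have hbelow : IsBoundedUnder (· ≥ ·) atTop
      (fun n : ℕ => ({i : ℕ | i < n ∧ P i}.ncard : ℝ) / n) :=
    isBoundedUnder_of ⟨0, ncard_lt_div_nonneg P⟩
  have habove : IsBoundedUnder (· ≤ ·) atTop
      (fun n : ℕ => ({i : ℕ | i < n ∧ P i}.ncard : ℝ) / n) :=
    isBoundedUnder_of ⟨1, ncard_lt_div_le_one P⟩
  refine le_antisymm (le_of_forall_pos_le_add fun δ hδ => ?_)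
    (le_liminf_of_le habove.isCoboundedUnder_ge (Eventually.of_forall (ncard_lt_div_nonneg P)))
  rw [zero_add]
  exact liminf_le_of_frequently_le
    ((frequently_ncard_lt_div_le hP hδ).mono fun _ h => h.1) hbelow

theorem limsup_ncard_lt_div_eq_one {P : ℕ → Prop} {H : ℕ}
    (hP : ∃ᶠ j in atTop, ∀ n, j ! + H ≤ n → n + H < (j + 1)! → P n) :
    limsup (fun n : ℕ => ({i : ℕ | i < n ∧ P i}.ncard : ℝ) / n) atTop = 1 := by
  have hbelow : IsBoundedUnder (· ≥ ·) atTop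
      (fun n : ℕ => ({i : ℕ | i < n ∧ P i}.ncard : ℝ) / n) :=
    isBoundedUnder_of ⟨0, ncard_lt_div_nonneg P⟩
  have habove : IsBoundedUnder (· ≤ ·) atTop
      (fun n : ℕ => ({i : ℕ | i < n ∧ P i}.ncard : ℝ) / n) :=
    isBoundedUnder_of ⟨1, ncard_lt_div_le_one P⟩
  refine le_antisymm
    (limsup_le_of_le hbelow.isCoboundedUnder_le (Eventually.of_forall (ncard_lt_div_le_one P)))
    (le_of_forall_pos_le_add fun δ hδ => ?_)
  have hP' : ∃ᶠ j in atTop, ∀ n, j ! + H ≤ n → n + H < (j + 1)! → ¬ ¬ P n :=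
    hP.mono fun j hj n h1 h2 => not_not.2 (hj n h1 h2)
  rw [← sub_le_iff_le_add]
  refine le_limsup_of_frequently_le
    ((frequently_ncard_lt_div_le hP' hδ).mono fun n hn => ?_) habove
  have hn0 : (0 : ℝ) < n := by exact_mod_cast hn.2
  have h1 : ({i : ℕ | i < n ∧ P i}.ncard : ℝ) + ({i : ℕ | i < n ∧ ¬ P i}.ncard : ℝ) = n := by
    exact_mod_cast ncard_lt_add_ncard_lt_not P n
  have h2 := hn.1
  rw [div_le_iff₀ hn0] at h2
  rw [le_div_iff₀ hn0]
  linarith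

end Density

section Construction

open scoped Nat

variable {X Γ : Type*}

theorem exists_frequently_eq (τ : Type*) [Countable τ] [Nonempty τ] :
    ∃ T : ℕ → τ, ∀ t, ∃ᶠ j in atTop, T j = t := by
  obtain ⟨f, hf⟩ := exists_surjective_nat (τ × ℕ)
  refine ⟨fun j => (f j).1, fun t => Nat.frequently_atTop_iff_infinite.2 ?_⟩
  choose g hg using hf
  refine Set.infinite_of_injective_forall_mem (f := fun n : ℕ => g (t, n)) (fun m n hmn => ?_)
    fun n => by simp [hg]
  have := congrArg (fun j => (f j).2) hmn
  simpa [hg] using this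

theorem eventually_factorial_gap (H : ℕ) :
    ∀ᶠ j in atTop, j ! + H ≤ j ! + j ∧ j ! + j + H < (j + 1)! := by
  filter_upwards [eventually_ge_atTop H, eventually_ge_atTop 3] with j h1 h2
  have h3 : 3 ≤ j ! := h2.trans (Nat.self_le_factorial j)
  rw [Nat.factorial_succ]
  refine ⟨by omega, ?_⟩
  nlinarith

theorem exists_lt_factorial_succ (t : ℕ) : ∃ j, t < (j + 1)! :=
  ⟨t, Nat.self_le_factorial (t + 1)⟩

/-- The index `j` of the block `[j!, (j+1)!)` that contains `t`. -/
noncomputable def blockIndex (t : ℕ) : ℕ := Nat.find (exists_lt_factorial_succ t)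

theorem blockIndex_eq {t j : ℕ} (h₁ : j ! ≤ t) (h₂ : t < (j + 1)!) : blockIndex t = j :=
  (Nat.find_eq_iff _).2
    ⟨h₂, fun _ hi => not_lt.2 ((Nat.factorial_le (Nat.succ_le_of_lt hi)).trans h₁)⟩

open Classical in
/-- The values used on the `j`-th block, according to its kind: `none` is the constant `x₀`,
`some (inl i)` records whether `i ∈ c`, and `some (inr k)` displays the point `q k`
at time `j! + j`. -/
noncomputable def blockValue (ψ : Γ → Γ) (x₀ x₁ : X) (q : ℕ → Γ → X) (c : Set ℕ) (j : ℕ) :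
    Option (ℕ ⊕ ℕ) → Γ → X
  | none => fun _ => x₀
  | some (.inl i) => fun _ => if i ∈ c then x₀ else x₁
  | some (.inr k) => Function.extend (ψ^[j ! + j]) (q k) fun _ => x₀

/-- The point coinciding with `q p.1` below height `p.2`, and following the sequence of blocks of
kinds `T` afterwards. -/
noncomputable def blockPoint (ψ : Γ → Γ) (h : Γ → ℤ) (x₀ x₁ : X) (q : ℕ → Γ → X)
    (T : ℕ → Option (ℕ ⊕ ℕ)) (p : ℕ × ℕ) (c : Set ℕ) : Γ → X := fun γ =>
  if h γ < p.2 then q p.1 γ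
  else blockValue ψ x₀ x₁ q c (blockIndex (h γ).toNat) (T (blockIndex (h γ).toNat)) γ

variable {ψ : Γ → Γ} {h : Γ → ℤ} {x₀ x₁ : X} {q : ℕ → Γ → X} {T : ℕ → Option (ℕ ⊕ ℕ)}

theorem iterate_genShift_blockPoint (hh : ∀ γ, h (ψ γ) = h γ + 1) (p : ℕ × ℕ) (c : Set ℕ)
    {H j n : ℕ} {γ : Γ} (hγ : (h γ).natAbs ≤ H) (h₁ : j ! + (H + p.2) ≤ n)
    (h₂ : n + (H + p.2) < (j + 1)!) :
    (genShift ψ)^[n] (blockPoint ψ h x₀ x₁ q T p c) γ =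
      blockValue ψ x₀ x₁ q c j (T j) (ψ^[n] γ) := by
  have hn := height_iterate hh n γ
  have hj : blockIndex (h (ψ^[n] γ)).toNat = j := blockIndex_eq (by omega) (by omega)
  rw [genShift_iterate_apply, blockPoint, if_neg (by omega), hj]

theorem frequently_block_eq (hh : ∀ γ, h (ψ γ) = h γ + 1) (hT : ∀ t, ∃ᶠ j in atTop, T j = t)
    (p p' : ℕ × ℕ) (c c' : Set ℕ) (D : Finset Γ) :
    ∃ H : ℕ, ∃ᶠ j in atTop, ∀ n, j ! + H ≤ n → n + H < (j + 1)! → ∀ γ ∈ D,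
      (genShift ψ)^[n] (blockPoint ψ h x₀ x₁ q T p c) γ =
        (genShift ψ)^[n] (blockPoint ψ h x₀ x₁ q T p' c') γ := by
  obtain ⟨H, hH⟩ := exists_natAbs_bound h D
  refine ⟨H + p.2 + p'.2, (hT none).mono fun j hj n h₁ h₂ γ hγ => ?_⟩
  rw [iterate_genShift_blockPoint (j := j) hh p c (hH γ hγ) (by omega) (by omega),
    iterate_genShift_blockPoint (j := j) hh p' c' (hH γ hγ) (by omega) (by omega), hj]
  rfl

theorem frequently_block_ne (hh : ∀ γ, h (ψ γ) = h γ + 1) (hT : ∀ t, ∃ᶠ j in atTop, T j = t)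
    (hx : x₀ ≠ x₁) (p p' : ℕ × ℕ) {c c' : Set ℕ} (hc : c ≠ c') (γ : Γ) :
    ∃ H : ℕ, ∃ᶠ j in atTop, ∀ n, j ! + H ≤ n → n + H < (j + 1)! →
      (genShift ψ)^[n] (blockPoint ψ h x₀ x₁ q T p c) γ ≠
        (genShift ψ)^[n] (blockPoint ψ h x₀ x₁ q T p' c') γ := by
  obtain ⟨i, hi⟩ : ∃ i, ¬ (i ∈ c ↔ i ∈ c') := by
    by_contra! hcon
    exact hc (Set.ext hcon)
  refine ⟨(h γ).natAbs + p.2 + p'.2, (hT (some (.inl i))).mono fun j hj n h₁ h₂ => ?_⟩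
  rw [iterate_genShift_blockPoint (j := j) hh p c le_rfl (by omega) (by omega),
    iterate_genShift_blockPoint (j := j) hh p' c' le_rfl (by omega) (by omega), hj]
  by_cases h1 : i ∈ c <;> by_cases h2 : i ∈ c' <;> simp_all [blockValue, eq_comm]

theorem blockPoint_ne (hh : ∀ γ, h (ψ γ) = h γ + 1) (hT : ∀ t, ∃ᶠ j in atTop, T j = t)
    (hx : x₀ ≠ x₁) [Nonempty Γ] (p p' : ℕ × ℕ) {c c' : Set ℕ} (hc : c ≠ c') :
    blockPoint ψ h x₀ x₁ q T p c ≠ blockPoint ψ h x₀ x₁ q T p' c' := by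
  intro heq
  obtain ⟨H, hH⟩ :=
    frequently_block_ne (q := q) hh hT hx p p' hc (Classical.arbitrary Γ)
  obtain ⟨j, hj, h₁, h₂⟩ := (hH.and_eventually (eventually_factorial_gap H)).exists
  exact hj _ h₁ h₂ (by rw [heq])

theorem transitivePoint_blockPoint [TopologicalSpace X] (hψ : Function.Injective ψ)
    (hh : ∀ γ, h (ψ γ) = h γ + 1) (hT : ∀ t, ∃ᶠ j in atTop, T j = t) (hq : DenseRange q)
    (p : ℕ × ℕ) (c : Set ℕ) :
    TransitivePoint (genShift ψ) (blockPoint ψ h x₀ x₁ q T p c) := by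
  refine dense_iff_inter_open.2 fun U hU hne => ?_
  obtain ⟨k, hk⟩ := hq.exists_mem_open hU hne
  obtain ⟨D, hD⟩ := exists_finset_cylinder_subset hU hk
  obtain ⟨H, hH⟩ := exists_natAbs_bound h D
  obtain ⟨j, hj, h₁, h₂⟩ :=
    ((hT (some (.inr k))).and_eventually (eventually_factorial_gap (H + p.2))).exists
  refine ⟨_, hD _ fun γ hγ => ?_, j ! + j, rfl⟩
  refine (iterate_genShift_blockPoint hh p c (hH γ hγ) h₁ h₂).trans ?_
  rw [hj, blockValue]
  exact (hψ.iterate _).extend_apply _ _ _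

theorem dense_range_blockPoint [TopologicalSpace X] (hq : DenseRange q)
    {π : Set ℕ → ℕ × ℕ} (hπ : Function.Surjective π) :
    DenseRange fun c : Set ℕ => blockPoint ψ h x₀ x₁ q T (π c) c := by
  refine dense_iff_inter_open.2 fun U hU hne => ?_
  obtain ⟨k, hk⟩ := hq.exists_mem_open hU hne
  obtain ⟨D, hD⟩ := exists_finset_cylinder_subset hU hk
  obtain ⟨H, hH⟩ := exists_natAbs_bound h D
  obtain ⟨c, hc⟩ := hπ (k, H + 1)
  refine ⟨_, hD _ fun γ hγ => ?_, c, rfl⟩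
  have := hH γ hγ
  simp only [blockPoint, hc]
  rw [if_pos (by omega)]

theorem not_countable_range_of_injective_set {Y : Type*} {f : Set ℕ → Y}
    (hf : Function.Injective f) : ¬ (Set.range f).Countable := by
  intro hc
  have : Countable (Set ℕ) := by
    have := hc.to_subtype
    exact (Equiv.ofInjective f hf).countable_iff.2 this
  obtain ⟨g, hg⟩ := exists_surjective_nat (Set ℕ)
  exact Function.cantor_surjective g hg

theorem transitiveDC_of_injective [Finite X] [TopologicalSpace X] [DiscreteTopology X]
    [Nontrivial X] [Countable Γ] [Nonempty Γ] (hψ : Function.Injective ψ)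
    (hper : ∀ θ, ¬ PeriodicPt ψ θ) {d : (Γ → X) → (Γ → X) → ℝ}
    (hd : IsCompatibleMetric (Γ → X) d) : TransitiveDC d (genShift (X := X) ψ) := by
  obtain ⟨h, hh⟩ := exists_height hper
  obtain ⟨x₀, x₁, hx⟩ := exists_pair_ne X
  obtain ⟨T, hT⟩ := exists_frequently_eq (Option (ℕ ⊕ ℕ))
  obtain ⟨q, hq⟩ := TopologicalSpace.exists_dense_seq (Γ → X)
  obtain ⟨π, hπ⟩ : ∃ π : Set ℕ → ℕ × ℕ, Function.Surjective π := by
    have hinj : Function.Injective fun p : ℕ × ℕ => ({Nat.pair p.1 p.2} : Set ℕ) := by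
      intro p p' hpp
      have := Set.singleton_injective hpp
      exact Nat.pairEquiv.injective this
    exact ⟨_, Function.invFun_surjective hinj⟩
  obtain ⟨ε, hε, hdε⟩ := hd.exists_pos_forall_eq (Classical.arbitrary Γ)
  let f : Set ℕ → Γ → X := fun c => blockPoint ψ h x₀ x₁ q T (π c) c
  have hfinj : Function.Injective f := fun c c' hcc => by
    by_contra hne
    exact blockPoint_ne hh hT hx _ _ hne hcc
  have hF : ∀ x ∈ Set.range f, ∀ y ∈ Set.range f, x ≠ y → Fdist d (genShift ψ) x y ε = 0 := by
    rintro _ ⟨c, rfl⟩ _ ⟨c', rfl⟩ hne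
    obtain ⟨H, hH⟩ := frequently_block_ne (q := q) hh hT hx (π c) (π c')
      (ne_of_apply_ne f hne) (Classical.arbitrary Γ)
    exact liminf_ncard_lt_div_eq_zero
      (hH.mono fun j hj n h₁ h₂ hlt => hj n h₁ h₂ (hdε _ _ hlt))
  have hFstar : ∀ x ∈ Set.range f, ∀ y ∈ Set.range f, ∀ s > 0,
      FdistStar d (genShift ψ) x y s = 1 := by
    rintro _ ⟨c, rfl⟩ _ ⟨c', rfl⟩ s hs
    obtain ⟨D, hD⟩ := hd.exists_finset_forall_lt hs
    obtain ⟨H, hH⟩ := frequently_block_eq (q := q) (x₀ := x₀) (x₁ := x₁) hh hT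
      (π c) (π c') c c' D
    exact limsup_ncard_lt_div_eq_one (hH.mono fun j hj n h₁ h₂ => hD _ _ (hj n h₁ h₂))
  have hunc : ¬ (Set.range f).Countable := not_countable_range_of_injective_set hfinj
  refine ⟨Set.range f, hunc, dense_range_blockPoint hq hπ, ?_, ⟨?_, ?_⟩, ε, hε, hF⟩
  · rintro _ ⟨c, rfl⟩
    exact transitivePoint_blockPoint hψ hh hT hq _ _
  · exact Set.not_subsingleton_iff.1 fun hs => hunc hs.countable
  · exact fun x hx' y hy hne => ⟨⟨ε, hε, hF x hx' y hy hne⟩, hFstar x hx' y hy⟩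

end Construction

variable {X : Type*} [Fintype X] [TopologicalSpace X] [DiscreteTopology X] [Nontrivial X]
variable {Γ : Type*} [Countable Γ] [Nonempty Γ]
/-- for any compatible metric `d` on `X^Γ`, `(X^Γ, σ_φ)` is transitive
distributionally chaotic iff `φ` is one-to-one and has no periodic point. -/
theorem transitiveDC_iff_injective_and_no_periodicPt
    (φ : Γ → Γ)
    (d : (Γ → X) → (Γ → X) → ℝ) (hd : IsCompatibleMetric (Γ → X) d) :
    TransitiveDC d (genShift (X := X) φ) ↔
      (Function.Injective φ ∧ ∀ θ : Γ, ¬ PeriodicPt φ θ) := by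
  constructor
  · rintro ⟨A, -, -, htrans, ⟨hA, -⟩, -⟩
    obtain ⟨a, ha⟩ := hA.nonempty
    exact ⟨(htrans a ha).injective, (htrans a ha).not_periodicPt⟩
  · rintro ⟨hinj, hper⟩
    exact transitiveDC_of_injective hinj hper hd
end
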